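/- Let α = {a_0, …, a_d} be a d-simplex in ℝ^N. Then the Delaunay weight ω(α) = -∫_{x ∈ Conv(α)} Pow_α(x) dx is given by the closed formula ω(α) = (1/((d+1)(d+2))) · Vol(α) · Σ_{0 ≤ i < j ≤ d} ‖a_i - a_j‖², where Vol(α) is the d-dimensional volume of Conv(α). -/

import Mathlib

open scoped BigOperators MeasureTheory
open MeasureTheory

namespace DelaunayAux

section core
set_option linter.unusedSectionVars false
variable {d : ℕ} {V : Type*} [NormedAddCommGroup V] [NormedSpace ℝ V] [FiniteDimensional ℝ V]
  (b : AffineBasis (Fin (d + 1)) ℝ V)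

/-- The affine map fixing all vertices except `b j`, sent to the midpoint of `b i`, `b j`. -/
noncomputable def foldMap (i j : Fin (d + 1)) (x : V) : V :=
  x + (-(1 / 2) * b.coord j x) • (b j - b i)

lemma coord_shift (k i j : Fin (d + 1)) (x : V) (r : ℝ) :
    b.coord k (x + r • (b j - b i)) =
      b.coord k x + r * (b.coord k (b j) - b.coord k (b i)) := by
  have h1 : x + r • (b j - b i) = (r • (b j - b i)) +ᵥ x := by
    simp [vadd_eq_add, add_comm]
  have h2 : (b.coord k).linear (b j - b i) = b.coord k (b j) - b.coord k (b i) := by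
    have := (b.coord k).linearMap_vsub (b j) (b i)
    simpa using this
  rw [h1, AffineMap.map_vadd, map_smul, h2]
  simp [add_comm]

lemma continuous_coord (k : Fin (d + 1)) : Continuous (b.coord k) :=
  (b.coord k).continuous_of_finiteDimensional

lemma foldMap_injective {i j : Fin (d + 1)} (hij : i ≠ j) : Function.Injective (foldMap b i j) := by
  intro x y h
  have hj : b.coord j x = b.coord j y := by
    have := congrArg (b.coord j) h
    simp only [foldMap, coord_shift, b.coord_apply_eq, b.coord_apply_ne hij.symm] at this
    linarith
  simpa [foldMap, hj] using h

lemma foldMap_image {i j : Fin (d + 1)} (hij : i ≠ j) :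
    foldMap b i j '' (convexHull ℝ (Set.range b)) =
      convexHull ℝ (Set.range b) ∩ {x | b.coord j x ≤ b.coord i x} := by
  rw [b.convexHull_eq_nonneg_coord]
  ext y
  constructor
  · rintro ⟨x, hx, rfl⟩
    have hx' : ∀ k, 0 ≤ b.coord k x := hx
    refine ⟨fun k => ?_, ?_⟩
    · have h1 := hx' k
      have h2 := hx' j
      simp only [foldMap, coord_shift, b.coord_apply]
      split_ifs <;> subst_vars <;> linarith
    · have h1 := hx' i
      simp only [foldMap, Set.mem_ofPred_eq, coord_shift, b.coord_apply_eq,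
        b.coord_apply_ne hij.symm, b.coord_apply_ne hij]
      linarith
  · rintro ⟨hy, hy2⟩
    have hy' : ∀ k, 0 ≤ b.coord k y := hy
    have hy2' : b.coord j y ≤ b.coord i y := hy2
    refine ⟨y + (b.coord j y) • (b j - b i), fun k => ?_, ?_⟩
    · have h1 := hy' k
      have h2 := hy' j
      simp only [coord_shift, b.coord_apply]
      split_ifs <;> subst_vars <;> linarith
    · simp only [foldMap, coord_shift, b.coord_apply_eq, b.coord_apply_ne hij.symm]
      module

variable [MeasurableSpace V] [BorelSpace V] (μ : Measure V) [μ.IsAddHaarMeasure]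

lemma isCompact_hull : IsCompact (convexHull ℝ (Set.range b)) :=
  (Set.finite_range b).isCompact_convexHull ℝ

lemma integral_half {i j : Fin (d + 1)} (hij : i ≠ j) (F : V → ℝ) :
    ∫ x in convexHull ℝ (Set.range b) ∩ {x | b.coord j x ≤ b.coord i x}, F x ∂μ =
      (1 / 2) * ∫ x in convexHull ℝ (Set.range b), F (foldMap b i j x) ∂μ := by
  let L : V →L[ℝ] V :=
    LinearMap.toContinuousLinearMap
      (LinearMap.transvection (b.coord j).linear ((-(1 / 2) : ℝ) • (b j - b i)))
  have hdet : L.det = 1 / 2 := by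
    have h2 : (b.coord j).linear (b j - b i) = 1 := by
      have := (b.coord j).linearMap_vsub (b j) (b i)
      simpa [b.coord_apply_ne hij.symm] using this
    change LinearMap.det _ = _
    rw [show (L : V →ₗ[ℝ] V) = LinearMap.transvection (b.coord j).linear
      ((-(1 / 2) : ℝ) • (b j - b i)) from rfl, LinearMap.transvection.det, map_smul, h2]
    norm_num
  have hd : ∀ x, HasFDerivAt (foldMap b i j) L x := by
    intro x
    have : foldMap b i j = fun x => L x + foldMap b i j 0 := by
      funext x
      have hx : b.coord j x = (b.coord j).linear x + b.coord j 0 := by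
        have := (b.coord j).map_vadd 0 x
        simpa using this
      have hL : L x = x + (b.coord j).linear x • ((-(1 / 2) : ℝ) • (b j - b i)) := by
        change LinearMap.transvection _ _ x = _
        simp [LinearMap.transvection.apply]
      rw [hL]
      simp only [foldMap, hx]
      module
    rw [this]
    exact L.hasFDerivAt.add_const _
  rw [← foldMap_image b hij, integral_image_eq_integral_abs_det_fderiv_smul μ
    (isCompact_hull b).measurableSet (fun x _ => (hd x).hasFDerivWithinAt)
    (foldMap_injective b hij).injOn]
  rw [hdet, ← integral_const_mul]
  norm_num

lemma integral_split {i j : Fin (d + 1)} (hij : i ≠ j) (F : V → ℝ) (hF : Continuous F) :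
    ∫ x in convexHull ℝ (Set.range b), F x ∂μ =
      (1 / 2) * ∫ x in convexHull ℝ (Set.range b), F (foldMap b i j x) ∂μ +
      (1 / 2) * ∫ x in convexHull ℝ (Set.range b), F (foldMap b j i x) ∂μ := by
  rw [← integral_half b μ hij, ← integral_half b μ hij.symm]
  have hi : IntegrableOn F (convexHull ℝ (Set.range b)) μ :=
    hF.continuousOn.integrableOn_compact (isCompact_hull b)
  rw [← setIntegral_union₀ _ _ (hi.mono_set Set.inter_subset_left)
    (hi.mono_set Set.inter_subset_left), ← Set.inter_union_distrib_left]
  · congr 2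
    symm
    rw [Set.inter_eq_left]
    intro x _
    exact le_total (b.coord j x) (b.coord i x)
  · let s : AffineSubspace ℝ V := (affineSpan ℝ {(0 : ℝ)}).comap (b.coord i - b.coord j)
    have hs : s ≠ ⊤ := by
      intro h
      have : b i ∈ s := h ▸ AffineSubspace.mem_top ℝ V (b i)
      simp [s, AffineSubspace.mem_comap, b.coord_apply_ne hij.symm] at this
    refine measure_mono_null ?_ (Measure.addHaar_affineSubspace μ s hs)
    rintro x ⟨⟨_, h1⟩, ⟨_, h2⟩⟩
    have h3 : b.coord i x = b.coord j x := le_antisymm h2 h1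
    simp [s, h3]
  · exact ((isCompact_hull b).measurableSet.inter
      (measurableSet_le (continuous_coord b i).measurable
        (continuous_coord b j).measurable)).nullMeasurableSet

lemma integrable_cc (i j : Fin (d + 1)) : IntegrableOn (fun x => b.coord i x * b.coord j x)
    (convexHull ℝ (Set.range b)) μ :=
  ((continuous_coord b i).mul (continuous_coord b j)).continuousOn.integrableOn_compact
    (isCompact_hull b)

lemma moments {i j : Fin (d + 1)} (hij : i ≠ j) :
    (∫ x in convexHull ℝ (Set.range b), b.coord i x * b.coord j x ∂μ =
      (1 / 2) * ∫ x in convexHull ℝ (Set.range b), b.coord i x * b.coord i x ∂μ) ∧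
    ∫ x in convexHull ℝ (Set.range b), b.coord j x * b.coord j x ∂μ =
      ∫ x in convexHull ℝ (Set.range b), b.coord i x * b.coord i x ∂μ := by
  have hii := integrable_cc b μ i i
  have hij' := integrable_cc b μ i j
  have hjj := integrable_cc b μ j j
  have key : ∀ p q r : ℝ, ∫ x in convexHull ℝ (Set.range b), (p * (b.coord i x * b.coord i x) +
      q * (b.coord i x * b.coord j x) + r * (b.coord j x * b.coord j x)) ∂μ =
      p * ∫ x in convexHull ℝ (Set.range b), b.coord i x * b.coord i x ∂μ +
      q * ∫ x in convexHull ℝ (Set.range b), b.coord i x * b.coord j x ∂μ +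
      r * ∫ x in convexHull ℝ (Set.range b), b.coord j x * b.coord j x ∂μ := by
    intro p q r
    rw [integral_add, integral_add, integral_const_mul, integral_const_mul, integral_const_mul]
    · exact hii.const_mul p
    · exact hij'.const_mul q
    · exact (hii.const_mul p).add (hij'.const_mul q)
    · exact hjj.const_mul r
  have e1 := integral_split b μ hij (fun x => b.coord i x * b.coord j x)
    ((continuous_coord b i).mul (continuous_coord b j))
  have e2 := integral_split b μ hij (fun x => b.coord i x * b.coord i x)
    ((continuous_coord b i).mul (continuous_coord b i))
  simp only [foldMap, coord_shift, b.coord_apply_eq, b.coord_apply_ne hij,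
    b.coord_apply_ne hij.symm] at e1 e2
  have k1 := key 0 (1 / 2) (1 / 4)
  have k2 := key (1 / 4) (1 / 2) 0
  have k3 := key 1 1 (1 / 4)
  have k4 := key (1 / 4) 0 0
  ring_nf at e1 e2 k1 k2 k3 k4 ⊢
  rw [k1, k2] at e1
  rw [k3, k4] at e2
  constructor <;> linarith

lemma integral_coord_mul {i j : Fin (d + 1)} (hij : i ≠ j) :
    ∫ x in convexHull ℝ (Set.range b), b.coord i x * b.coord j x ∂μ =
      (1 / ((d + 1) * (d + 2) : ℝ)) * (μ (convexHull ℝ (Set.range b))).toReal := by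
  set B := ∫ x in convexHull ℝ (Set.range b), b.coord i x * b.coord i x ∂μ with hB
  have hkk : ∀ k, ∫ x in convexHull ℝ (Set.range b), b.coord k x * b.coord k x ∂μ = B := by
    intro k
    by_cases h : i = k
    · subst h; rfl
    · exact (moments b μ h).2
  have hkl : ∀ k l, ∫ x in convexHull ℝ (Set.range b), b.coord k x * b.coord l x ∂μ =
      B / 2 + if k = l then B / 2 else 0 := by
    intro k l
    split_ifs with h
    · subst h; rw [hkk]; ring
    · rw [(moments b μ h).1, hkk]; ring
  have hV : (μ (convexHull ℝ (Set.range b))).toReal =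
      ∑ k, ∑ l, ∫ x in convexHull ℝ (Set.range b), b.coord k x * b.coord l x ∂μ := by
    have h1 : ∀ x, ∑ k, ∑ l, b.coord k x * b.coord l x = 1 := by
      intro x
      simp_rw [← Finset.mul_sum, b.sum_coord_apply_eq_one, mul_one]
      exact b.sum_coord_apply_eq_one x
    calc _ = ∫ x in convexHull ℝ (Set.range b), (1 : ℝ) ∂μ := by simp [Measure.real]
      _ = ∫ x in convexHull ℝ (Set.range b), ∑ k, ∑ l, b.coord k x * b.coord l x ∂μ := by
        simp only [h1]
      _ = _ := by
        rw [integral_finsetSum]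
        · refine Finset.sum_congr rfl fun k _ => ?_
          rw [integral_finsetSum]
          exact fun l _ => integrable_cc b μ k l
        · exact fun k _ => integrable_finsetSum _ fun l _ => integrable_cc b μ k l
  rw [hV, (moments b μ hij).1]
  simp only [hkl, Finset.sum_add_distrib, Finset.sum_ite_eq, Finset.mem_univ, if_true,
    Finset.sum_const, Finset.card_univ, Fintype.card_fin, nsmul_eq_mul]
  push_cast
  field_simp
  ring

end core

lemma sum_Ioi_eq {d : ℕ} (f : Fin (d + 1) → Fin (d + 1) → ℝ) (hs : ∀ i j, f i j = f j i)
    (h0 : ∀ i, f i i = 0) :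
    ∑ i, ∑ j ∈ Finset.Ioi i, f i j = (1 / 2) * ∑ i, ∑ j, f i j := by
  have h1 : ∀ i, ∑ j, f i j = ∑ j ∈ Finset.Ioi i, f i j + ∑ j ∈ Finset.Iio i, f i j := by
    intro i
    have e1 : Finset.Ioi i = Finset.univ.filter (fun j => i < j) := by ext; simp
    have e2 : Finset.Iio i = Finset.univ.filter (fun j => j < i) := by ext; simp
    rw [e1, e2, Finset.sum_filter, Finset.sum_filter, ← Finset.sum_add_distrib]
    refine Finset.sum_congr rfl fun j _ => ?_
    rcases lt_trichotomy i j with h | h | h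
    · simp [h, h.not_gt]
    · subst h; simp [h0]
    · simp [h, h.not_gt]
  have h2 : ∑ i, ∑ j ∈ Finset.Iio i, f i j = ∑ i, ∑ j ∈ Finset.Ioi i, f i j := by
    rw [Finset.sum_comm' (t' := Finset.univ) (s' := fun j => Finset.Ioi j)]
    · exact Finset.sum_congr rfl fun i _ => Finset.sum_congr rfl fun j _ => hs _ _
    · intro x y; simp
  simp_rw [h1, Finset.sum_add_distrib]
  rw [h2]; ring

lemma norm_sq_combination {E : Type*} [NormedAddCommGroup E] [InnerProductSpace ℝ E] {d : ℕ}
    (u : Fin (d + 1) → E) (R : ℝ) (hu : ∀ i, ‖u i‖ = R) (t : Fin (d + 1) → ℝ)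
    (ht : ∑ i, t i = 1) :
    ‖∑ i, t i • u i‖ ^ 2 - R ^ 2 =
      -((1 / 2) * ∑ i, ∑ j, (t i * t j) * ‖u i - u j‖ ^ 2) := by
  have hin : ∀ i j, ‖u i - u j‖ ^ 2 = 2 * R ^ 2 - 2 * inner ℝ (u i) (u j) := by
    intro i j
    rw [norm_sub_sq_real, hu, hu]; ring
  have hR : ∑ i, ∑ j, (t i * t j) * R ^ 2 = R ^ 2 := by
    simp_rw [← Finset.sum_mul, ← Finset.mul_sum, ht, mul_one, ht, one_mul]
  have hI : ‖∑ i, t i • u i‖ ^ 2 = ∑ i, ∑ j, (t i * t j) * inner ℝ (u i) (u j) := by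
    rw [← real_inner_self_eq_norm_sq, sum_inner]
    refine Finset.sum_congr rfl fun i _ => ?_
    rw [inner_sum]
    refine Finset.sum_congr rfl fun j _ => ?_
    rw [real_inner_smul_left, real_inner_smul_right]; ring
  have : ∑ i, ∑ j, (t i * t j) * ‖u i - u j‖ ^ 2 =
      2 * ∑ i, ∑ j, (t i * t j) * R ^ 2 -
        2 * ∑ i, ∑ j, (t i * t j) * inner ℝ (u i) (u j) := by
    simp_rw [Finset.mul_sum, ← Finset.sum_sub_distrib]
    refine Finset.sum_congr rfl fun i _ => Finset.sum_congr rfl fun j _ => ?_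
    rw [hin]; ring
  rw [this, hR, hI]; ring

end DelaunayAux

/-- **Closed formula for the Delaunay weight (Chen–Holst).**
Let `α = {a 0, …, a d}` be a non-degenerate `d`-simplex in `ℝ^N`, with
circumcenter `Z` and circumradius `R`, and let the power distance be
`Pow_α(x) = ‖x - Z‖² - R²`.  Then, integrating with respect to the
`d`-dimensional (Hausdorff) measure on `Conv α`,
`-∫_{Conv α} Pow_α = (1/((d+1)(d+2))) · Vol(α) · ∑_{i<j} ‖a i - a j‖²`. -/
theorem delaunay_weight_formula
    {N d : ℕ} (a : Fin (d + 1) → EuclideanSpace ℝ (Fin N))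
    (hindep : AffineIndependent ℝ a)
    (Z : EuclideanSpace ℝ (Fin N)) (R : ℝ)
    (hcirc : ∀ i, ‖a i - Z‖ = R) :
    -∫ x in convexHull ℝ (Set.range a), (‖x - Z‖ ^ 2 - R ^ 2) ∂(μH[d]) =
      (1 / ((d + 1) * (d + 2) : ℝ)) *
        (μH[d] (convexHull ℝ (Set.range a))).toReal *
        ∑ i : Fin (d + 1), ∑ j ∈ Finset.Ioi i, ‖a i - a j‖ ^ 2 := by
  classical
  set W := vectorSpan ℝ (Set.range a) with hW
  let p : Fin (d + 1) → W := fun i =>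
    ⟨a i - a 0, vsub_mem_vectorSpan ℝ (Set.mem_range_self i) (Set.mem_range_self 0)⟩
  let φ : W →ᵃ[ℝ] EuclideanSpace ℝ (Fin N) :=
    W.subtype.toAffineMap + AffineMap.const ℝ W (a 0)
  have hφ : ∀ w : W, φ w = (w : EuclideanSpace ℝ (Fin N)) + a 0 := fun w => rfl
  have hφp : φ ∘ p = a := by
    funext i
    simp [hφ, p]
  have hiso : Isometry φ := by
    refine Isometry.of_dist_eq fun x y => ?_
    rw [hφ, hφ, dist_add_right]; rfl
  have hrank : Module.finrank ℝ W = d := hindep.finrank_vectorSpan (by simp)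
  have hp : AffineIndependent ℝ p := AffineIndependent.of_comp φ (by rw [hφp]; exact hindep)
  have htop : affineSpan ℝ (Set.range p) = ⊤ := by
    rw [hp.affineSpan_eq_top_iff_card_eq_finrank_add_one, hrank]
    simp
  let b : AffineBasis (Fin (d + 1)) ℝ W := ⟨p, hp, htop⟩
  have hb : (b : Fin (d + 1) → W) = p := rfl
  have : (μH[d] : Measure W).IsAddHaarMeasure := by
    have := MeasureTheory.isAddHaarMeasure_hausdorffMeasure (E := W)
    rwa [hrank] at this
  have hhull : convexHull ℝ (Set.range a) = φ '' convexHull ℝ (Set.range b) := by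
    rw [AffineMap.image_convexHull, ← Set.range_comp, hb, hφp]
  have hd0 : (0 : ℝ) ≤ d := Nat.cast_nonneg d
  have hvol : μH[d] (convexHull ℝ (Set.range a)) = μH[d] (convexHull ℝ (Set.range b)) := by
    rw [hhull, hiso.hausdorffMeasure_image (Or.inl hd0)]
  have hemb : MeasurableEmbedding φ := hiso.isClosedEmbedding.measurableEmbedding
  have hint : ∀ F : EuclideanSpace ℝ (Fin N) → ℝ,
      ∫ x in convexHull ℝ (Set.range a), F x ∂(μH[d]) =
        ∫ x in convexHull ℝ (Set.range b), F (φ x) ∂(μH[d]) := by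
    intro F
    have h1 : (μH[d] : Measure (EuclideanSpace ℝ (Fin N))).restrict
        (convexHull ℝ (Set.range a)) =
        (Measure.map φ μH[d]).restrict (convexHull ℝ (Set.range a)) := by
      rw [hiso.map_hausdorffMeasure (Or.inl hd0), Measure.restrict_restrict_of_subset]
      rw [hhull]
      exact Set.image_subset_range _ _
    rw [h1, hemb.setIntegral_map, hhull, Set.preimage_image_eq _ hiso.injective]
  have hpow : ∀ x : W, ‖φ x - Z‖ ^ 2 - R ^ 2 =
      -((1 / 2) * ∑ i, ∑ j, (b.coord i x * b.coord j x) * ‖a i - a j‖ ^ 2) := by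
    intro x
    have hx : φ x - Z = ∑ i, b.coord i x • (a i - Z) := by
      have h1 := congrArg (Subtype.val) (b.linear_combination_coord_eq_self x)
      have h2 : ∑ i, b.coord i x • (a i - a 0) = (x : EuclideanSpace ℝ (Fin N)) := by
        rw [← h1]
        simp [hb, p]
      have h3 := b.sum_coord_apply_eq_one x
      rw [hφ, ← h2]
      simp_rw [smul_sub, Finset.sum_sub_distrib, ← Finset.sum_smul, h3]
      simp
    rw [hx, DelaunayAux.norm_sq_combination _ R hcirc _ (b.sum_coord_apply_eq_one x)]
    simp only [sub_sub_sub_cancel_right]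
  rw [hint, hvol, DelaunayAux.sum_Ioi_eq (fun i j => ‖a i - a j‖ ^ 2)
    (fun i j => by simp only [norm_sub_rev]) (fun i => by simp)]
  simp only [hpow]
  rw [integral_neg, neg_neg, integral_const_mul, integral_finsetSum]
  · rw [mul_left_comm]
    congr 1
    rw [Finset.mul_sum]
    refine Finset.sum_congr rfl fun i _ => ?_
    rw [integral_finsetSum, Finset.mul_sum]
    · refine Finset.sum_congr rfl fun j _ => ?_
      rw [integral_mul_const]
      by_cases hij : i = j
      · subst hij; simp
      · rw [DelaunayAux.integral_coord_mul b _ hij]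
    · exact fun j _ => (DelaunayAux.integrable_cc b _ i j).mul_const _
  · exact fun i _ => integrable_finsetSum _ fun j _ =>
      (DelaunayAux.integrable_cc b _ i j).mul_const _
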